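/- Let f be a translation invariant quadratic form with integer coefficients in s variables. Let p be a prime, let t ≥ 1 and k ≥ 0 be integers, and let a, b be integers with gcd(ab, p) = 1. Then S*_{p^t,b}(p^k, a) = p^{sk} if 0 ≤ k ≤ 2t, and S*_{p^t,b}(p^k, a) = p^{2st} · S(p^{k−2t}, a) if k > 2t. -/

import Mathlib

open scoped BigOperators

noncomputable section

attribute [local instance] Classical.propDecidable

/-- `e(z) = e^{2πiz}`. -/
def eC (x : ℝ) : ℂ := Complex.exp (2 * Real.pi * Complex.I * x)

/-- The quadratic form `f(x) = x M xᵀ`. -/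
def Qf {s : ℕ} (M : Matrix (Fin s) (Fin s) ℤ) (x : Fin s → ℤ) : ℤ :=
  ∑ i, ∑ j, x i * M i j * x j

/-- The Gauss sum `S*_{W,b}(q,a)`. -/
def SstarG {s : ℕ} (M : Matrix (Fin s) (Fin s) ℤ) (W : ℕ) (b : ℤ) (q : ℕ) (a : ℤ) : ℂ :=
  ∑ c ∈ Fintype.piFinset (fun _ : Fin s => Finset.Icc 1 (q * W)),
    if ∀ i, Nat.gcd (c i) q = 1 ∧ (c i : ℤ) ≡ b [ZMOD (W : ℤ)] then
      eC (((a * Qf M (fun i => (c i : ℤ))) : ℝ) / (q : ℝ))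
    else 0

/-- The complete sum `S(q,a)`. -/
def SfullG {s : ℕ} (M : Matrix (Fin s) (Fin s) ℤ) (q : ℕ) (a : ℤ) : ℂ :=
  ∑ c ∈ Fintype.piFinset (fun _ : Fin s => Finset.Icc 1 q),
    eC (((a * Qf M (fun i => (c i : ℤ))) : ℝ) / (q : ℝ))

/-- `B*_{W,b}(q) = φ(qW)^{-s} ∑_{1 ≤ a ≤ q, (a,q)=1} S*_{W,b}(q,a)`. -/
def BstarG {s : ℕ} (M : Matrix (Fin s) (Fin s) ℤ) (W : ℕ) (b : ℤ) (q : ℕ) : ℂ :=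
  ((Nat.totient (q * W) : ℂ) ^ s)⁻¹ *
    ∑ a ∈ Finset.Icc 1 q, if Nat.gcd a q = 1 then SstarG M W b q (a : ℤ) else 0

/-- `B(q) = q^{-s} ∑_{1 ≤ a ≤ q, (a,q)=1} S(q,a)`. -/
def BfullG {s : ℕ} (M : Matrix (Fin s) (Fin s) ℤ) (q : ℕ) : ℂ :=
  ((q : ℂ) ^ s)⁻¹ *
    ∑ a ∈ Finset.Icc 1 q, if Nat.gcd a q = 1 then SfullG M q (a : ℤ) else 0

/-- `f` is translation invariant, i.e. `1 · M = 0`. -/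
def TransInv {s : ℕ} (M : Matrix (Fin s) (Fin s) ℤ) : Prop :=
  ∀ j, ∑ i, M i j = 0

/-- The off-diagonal rank of `M` is at least `n`. -/
def RankOffGe {s : ℕ} (M : Matrix (Fin s) (Fin s) ℤ) (n : ℕ) : Prop :=
  ∃ (r : ℕ) (ι κ : Fin r → Fin s), Function.Injective ι ∧ Function.Injective κ ∧
    (∀ k l, ι k ≠ κ l) ∧ n ≤ (Matrix.of fun k l => (M (ι k) (κ l) : ℚ)).rank

theorem eC_intCast (n : ℤ) : eC (n : ℝ) = 1 := by
  rw [eC, Complex.exp_eq_one_iff]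
  exact ⟨n, by push_cast; ring⟩

theorem eC_add_intCast (x : ℝ) (n : ℤ) : eC (x + n) = eC x := by
  have h : eC (x + n) = eC x * eC (n : ℝ) := by
    simp only [eC, ← Complex.exp_add]
    congr 1
    push_cast
    ring
  rw [h, eC_intCast, mul_one]

theorem eC_div_eq_of_modEq {m n : ℤ} {q : ℕ} (hq : q ≠ 0) (h : m ≡ n [ZMOD (q : ℤ)]) :
    eC ((m : ℝ) / q) = eC ((n : ℝ) / q) := by
  obtain ⟨d, hd⟩ := h.dvd
  have hn : n = m + q * d := by linarith
  have hq' : (q : ℝ) ≠ 0 := by exact_mod_cast hq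
  have : (n : ℝ) / q = (m : ℝ) / q + (d : ℤ) := by
    rw [hn]
    push_cast
    field_simp
  rw [this, eC_add_intCast]

theorem Qf_modEq {s : ℕ} (M : Matrix (Fin s) (Fin s) ℤ) {x y : Fin s → ℤ} {N : ℤ}
    (h : ∀ i, x i ≡ y i [ZMOD N]) : Qf M x ≡ Qf M y [ZMOD N] :=
  Int.ModEq.sum fun i _ => Int.ModEq.sum fun j _ => ((h i).mul_right _).mul (h j)

/-- A translation invariant form does not see a common shift, and is homogeneous of degree two. -/
theorem Qf_const_add_mul {s : ℕ} {M : Matrix (Fin s) (Fin s) ℤ} (hsym : M.IsSymm)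
    (htri : TransInv M) (u v : ℤ) (x : Fin s → ℤ) :
    Qf M (fun i => u + v * x i) = v ^ 2 * Qf M x := by
  have hrow : ∀ i, ∑ j, M i j = 0 := fun i => by
    rw [← htri i]
    exact Finset.sum_congr rfl fun j _ => hsym.apply j i
  have hterm : ∀ i j, (u + v * x i) * M i j * (u + v * x j) =
      (u + v * x i) * u * M i j + u * v * (M i j * x j) + v ^ 2 * (x i * M i j * x j) :=
    fun i j => by ring
  have hcol : ∑ i, ∑ j, M i j * x j = 0 := by
    rw [Finset.sum_comm]
    exact Finset.sum_eq_zero fun j _ => by rw [← Finset.sum_mul, htri j, zero_mul]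
  simp only [Qf, hterm, Finset.sum_add_distrib, ← Finset.mul_sum, hrow, hcol]
  simp

/-- The sum of a function of residues modulo `N` over a box of side `N * L`. -/
theorem sum_piFinset_Icc_mul {s : ℕ} {A : Type*} [AddCommMonoid A] {N : ℕ} (hN : 0 < N) (L : ℕ)
    (F : (Fin s → ℕ) → A) (hF : ∀ z w : Fin s → ℕ, F (fun i => z i + N * w i) = F z) :
    ∑ y ∈ Fintype.piFinset (fun _ : Fin s => Finset.Icc 1 (N * L)), F y =
      L ^ s • ∑ z ∈ Fintype.piFinset (fun _ : Fin s => Finset.Icc 1 N), F z := by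
  have hcard : (Fintype.piFinset fun _ : Fin s => Finset.range L).card = L ^ s := by simp
  rw [← hcard, ← Finset.sum_const, ← Finset.sum_product']
  symm
  refine Finset.sum_nbij' (fun wz i => wz.2 i + N * wz.1 i)
    (fun y => (fun i => (y i - 1) / N, fun i => (y i - 1) % N + 1)) ?_ ?_ ?_ ?_ ?_
  · rintro ⟨w, z⟩ h
    simp only [Finset.mem_product, Fintype.mem_piFinset, Finset.mem_Icc, Finset.mem_range] at h ⊢
    intro i
    have h1 := h.2 i
    have h2 := Nat.mul_le_mul_left N (Nat.succ_le_of_lt (h.1 i))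
    rw [Nat.mul_succ] at h2
    omega
  · intro y h
    simp only [Finset.mem_product, Fintype.mem_piFinset, Finset.mem_Icc, Finset.mem_range] at h ⊢
    refine ⟨fun i => Nat.div_lt_of_lt_mul ?_, fun i => ⟨by omega, Nat.mod_lt _ hN⟩⟩
    have := h i
    omega
  · rintro ⟨w, z⟩ h
    simp only [Finset.mem_product, Fintype.mem_piFinset, Finset.mem_Icc] at h
    have hsub : ∀ i, z i + N * w i - 1 = z i - 1 + N * w i := fun i => by
      have := h.2 i
      omega
    have hlt : ∀ i, z i - 1 < N := fun i => by
      have := h.2 i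
      omega
    ext i
    · simp [hsub, Nat.add_mul_div_left _ _ hN, Nat.div_eq_of_lt (hlt i)]
    · have := (h.2 i).1
      simp only [hsub, Nat.add_mul_mod_self_left, Nat.mod_eq_of_lt (hlt i)]
      omega
  · intro y h
    simp only [Fintype.mem_piFinset, Finset.mem_Icc] at h
    funext i
    have h1 := (h i).1
    have h2 := Nat.mod_add_div (y i - 1) N
    dsimp only
    omega
  · rintro ⟨w, z⟩ -
    exact (hF z w).symm

/-- If the residue class of `b` modulo `W` is nonzero and consists of integers coprime to `q`,
then `S*` is a sum over a full box of side `q`. -/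
theorem SstarG_eq_sum_box {s : ℕ} {M : Matrix (Fin s) (Fin s) ℤ} (hsym : M.IsSymm)
    (htri : TransInv M) {W q : ℕ} {b : ℤ} (hW : 0 < W) (hb : ¬ (W : ℤ) ∣ b)
    (hcop : ∀ c : ℕ, (c : ℤ) ≡ b [ZMOD (W : ℤ)] → Nat.gcd c q = 1) (a : ℤ) :
    SstarG M W b q a = ∑ y ∈ Fintype.piFinset (fun _ : Fin s => Finset.Icc 1 q),
      eC (((a * ((W : ℤ) ^ 2 * Qf M (fun i => (y i : ℤ))) : ℤ) : ℝ) / (q : ℝ)) := by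
  obtain ⟨r, hr⟩ : ∃ r : ℕ, (r : ℤ) = b % W :=
    ⟨(b % W).toNat, Int.toNat_of_nonneg (Int.emod_nonneg _ (by omega))⟩
  have hrW : r < W := by
    have := Int.emod_lt_of_pos b (Int.natCast_pos.2 hW)
    omega
  have hr0 : 0 < r := by
    have : b % W ≠ 0 := fun h => hb (Int.dvd_of_emod_eq_zero h)
    omega
  have hmod : ∀ c : ℕ, (c : ℤ) ≡ b [ZMOD (W : ℤ)] ↔ c % W = r := fun c => by
    rw [Int.ModEq, ← hr]
    norm_cast
  rw [SstarG, ← Finset.sum_filter]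
  symm
  refine Finset.sum_nbij' (fun y i => r + W * (y i - 1)) (fun c i => c i / W + 1) ?_ ?_ ?_ ?_ ?_
  · intro y hy
    simp only [Fintype.mem_piFinset, Finset.mem_Icc] at hy
    simp only [Finset.mem_filter, Fintype.mem_piFinset, Finset.mem_Icc]
    have hm : ∀ i, ((r + W * (y i - 1) : ℕ) : ℤ) ≡ b [ZMOD (W : ℤ)] := fun i => by
      rw [hmod, Nat.add_mul_mod_self_left, Nat.mod_eq_of_lt hrW]
    refine ⟨fun i => ⟨by omega, ?_⟩, fun i => ⟨hcop _ (hm i), hm i⟩⟩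
    obtain ⟨d, hd⟩ := Nat.exists_eq_add_of_le (hy i).1
    have h2 := (hy i).2
    rw [hd] at h2 ⊢
    rw [Nat.add_sub_cancel_left]
    nlinarith
  · intro c hc
    simp only [Finset.mem_filter, Fintype.mem_piFinset, Finset.mem_Icc] at hc
    simp only [Fintype.mem_piFinset, Finset.mem_Icc]
    refine fun i => ⟨Nat.succ_pos _, Nat.succ_le_of_lt ((Nat.div_lt_iff_lt_mul hW).2 ?_)⟩
    refine lt_of_le_of_ne (hc.1 i).2 fun h => ?_
    have := (hmod _).1 (hc.2 i).2
    rw [h, Nat.mul_mod_left] at this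
    omega
  · intro y hy
    simp only [Fintype.mem_piFinset, Finset.mem_Icc] at hy
    funext i
    have := (hy i).1
    rw [Nat.add_mul_div_left _ _ hW, Nat.div_eq_of_lt hrW]
    omega
  · intro c hc
    simp only [Finset.mem_filter] at hc
    funext i
    have := (hmod _).1 (hc.2 i).2
    rw [Nat.add_sub_cancel, ← this]
    exact Nat.mod_add_div _ _
  · intro y hy
    simp only [Fintype.mem_piFinset, Finset.mem_Icc] at hy
    have : (fun i => ((r + W * (y i - 1) : ℕ) : ℤ)) =
        fun i => ((r : ℤ) - W) + W * (y i : ℤ) := by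
      funext i
      push_cast [(hy i).1]
      ring
    rw [this, Qf_const_add_mul hsym htri]
    push_cast
    rfl

theorem statement6 {s : ℕ} (M : Matrix (Fin s) (Fin s) ℤ) (hsym : M.IsSymm)
    (htri : TransInv M) (p : ℕ) (hp : Nat.Prime p) (t k : ℕ) (ht : 1 ≤ t) (a b : ℤ)
    (hab : Int.gcd (a * b) (p : ℤ) = 1) :
    (k ≤ 2 * t → SstarG M (p ^ t) b (p ^ k) a = (p : ℂ) ^ (s * k)) ∧
    (2 * t < k → SstarG M (p ^ t) b (p ^ k) a =
      (p : ℂ) ^ (2 * s * t) * SfullG M (p ^ (k - 2 * t)) a) := by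
  have hb : IsCoprime b (p : ℤ) := (Int.isCoprime_iff_gcd_eq_one.2 hab).of_mul_left_right
  have hpZ : (p : ℤ) ∣ ((p ^ t : ℕ) : ℤ) := by
    exact_mod_cast dvd_pow_self p (by omega)
  have hpb : ¬ (p : ℤ) ∣ b := fun h =>
    (Nat.prime_iff_prime_int.1 hp).not_isUnit (hb.isUnit_of_dvd' h dvd_rfl)
  rw [SstarG_eq_sum_box hsym htri (pow_pos hp.pos t) (fun h => hpb (hpZ.trans h))
    fun c hc => ?_]
  · constructor
    · intro hk
      obtain ⟨d, hd⟩ := Nat.exists_eq_add_of_le hk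
      have hone : ∀ y : Fin s → ℕ, eC (((a * (((p ^ t : ℕ) : ℤ) ^ 2 *
          Qf M (fun i => (y i : ℤ))) : ℤ) : ℝ) / ((p ^ k : ℕ) : ℝ)) = 1 := fun y => by
        rw [eC_div_eq_of_modEq (n := 0) (pow_pos hp.pos k).ne', Int.cast_zero, zero_div]
        · simpa using eC_intCast 0
        · refine (Int.modEq_zero_iff_dvd).2 (Dvd.dvd.mul_left (Dvd.dvd.mul_right ?_ _) _)
          push_cast
          rw [← pow_mul]
          exact pow_dvd_pow _ (by omega)
      simp only [hone]
      simp [← pow_mul, mul_comm]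
    · intro hk
      obtain ⟨m, rfl⟩ := Nat.exists_eq_add_of_le hk.le
      have hp0 : (p : ℝ) ≠ 0 := by exact_mod_cast hp.ne_zero
      rw [Nat.add_sub_cancel_left, show p ^ (2 * t + m) = p ^ m * p ^ (2 * t) by ring,
        sum_piFinset_Icc_mul (pow_pos hp.pos m)]
      · rw [SfullG, nsmul_eq_mul]
        congr 1
        · push_cast
          rw [← pow_mul]
          congr 1
          ring
        · refine Finset.sum_congr rfl fun y _ => ?_
          congr 1
          push_cast
          field_simp
          ring
      · intro z w
        refine eC_div_eq_of_modEq (mul_pos (pow_pos hp.pos _) (pow_pos hp.pos _)).ne' ?_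
        refine Int.ModEq.mul_left _ ?_
        have h := (Qf_modEq M (N := ((p ^ m : ℕ) : ℤ))
          (x := fun i => ((z i + p ^ m * w i : ℕ) : ℤ)) (y := fun i => (z i : ℤ))
          fun i => by simp [Int.ModEq]).mul_left' (c := ((p ^ t : ℕ) : ℤ) ^ 2)
        convert h using 1
        push_cast
        ring
  · refine Nat.Coprime.pow_right k ?_
    refine Nat.Coprime.symm ((hp.coprime_iff_not_dvd).2 fun h => hpb ?_)
    have hcb := (hc.of_dvd hpZ).dvd
    exact (Int.dvd_iff_dvd_of_dvd_sub hcb).2 (by exact_mod_cast h)
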